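/- arXiv:1603.03602 — 5 statements merged into one kernel-verified Lean document; each statement's English description precedes it below -/
import Mathlib

section
/- For every m ≥ 1 there exist maps Q_0^{(m)}, Q_1^{(m)}, …, Q_{m−1}^{(m)} from ℝ^m to the real symmetric positive semidefinite m×m matrices such that: (a) Q_ε^{(m)}(λ) = Σ_{i=0}^{m−1} ε^{2i} Q_i^{(m)}(λ) for all λ ∈ ℝ^m and all ε ∈ (0,1]; (b) every entry of every Q_i^{(m)}(λ) is a polynomial function of λ_1,…,λ_m that is invariant under every permutation of (λ_1,…,λ_m). -/
open Matrix

/-- The signed elementary symmetric function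
`σ_h(f) = (-1)^h ∑_{i_1 < ⋯ < i_h} f i_1 ⋯ f i_h`, with `σ_0 = 1`. -/
noncomputable def esymmSigned {n : ℕ} (h : ℕ) (f : Fin n → ℝ) : ℝ :=
  (-1 : ℝ) ^ h * ∑ S ∈ Finset.powersetCard h (Finset.univ : Finset (Fin n)), ∏ i ∈ S, f i

/-- `removeIdx lam i = π_i λ`, the vector `λ` with its `i`-th entry removed. -/
noncomputable def removeIdx {m : ℕ} (lam : Fin m → ℝ) (i : Fin m) : Fin (m - 1) → ℝ :=
  fun j =>
    if h : (j : ℕ) < (i : ℕ) then lam ⟨j, by have := i.2; omega⟩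
    else lam ⟨(j : ℕ) + 1, by have := j.2; omega⟩

/-- The recursively defined matrices `P^{(m)}(λ)`. -/
noncomputable def Pmat : (m : ℕ) → (Fin m → ℝ) → Matrix (Fin m) (Fin m) ℝ
  | 0, _ => 1
  | (n + 1), lam =>
      Matrix.of fun i j =>
        if hi : (i : ℕ) < n then
          if hj : (j : ℕ) < n then Pmat n (fun k => lam k.castSucc) ⟨i, hi⟩ ⟨j, hj⟩ else 0
        else
          if (j : ℕ) < n then esymmSigned (n - (j : ℕ)) (fun k => lam k.castSucc) else 1

/-- `P_ε^{(m)}(λ) = H_ε^{(m)} P^{(m)}(λ)` with `H_ε^{(m)} = diag(ε^{m-1}, …, ε, 1)`.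
(Note that for `ε = 0` this gives `H_0^{(m)} = diag(0, …, 0, 1)` since `0 ^ 0 = 1`.) -/
noncomputable def Peps (m : ℕ) (eps : ℝ) (lam : Fin m → ℝ) : Matrix (Fin m) (Fin m) ℝ :=
  Matrix.diagonal (fun i : Fin m => eps ^ (m - 1 - (i : ℕ))) * Pmat m lam

/-- The quasi-symmetriser `Q_ε^{(m)}(λ) = ∑_{ρ ∈ S_m} P_ε^{(m)}(λ_ρ)^T P_ε^{(m)}(λ_ρ)`.
For `ε = 0` this is the matrix `Q_0^{(m)}(λ)`. -/
noncomputable def Qeps (m : ℕ) (eps : ℝ) (lam : Fin m → ℝ) : Matrix (Fin m) (Fin m) ℝ :=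
  ∑ ρ : Equiv.Perm (Fin m),
    (Peps m eps (fun k => lam (ρ k)))ᵀ * Peps m eps (fun k => lam (ρ k))

theorem exists_eval_eq_esymmSigned {n : ℕ} (h : ℕ) :
    ∃ p : MvPolynomial (Fin n) ℝ, ∀ f : Fin n → ℝ, esymmSigned h f = MvPolynomial.eval f p :=
  ⟨(-1) ^ h * MvPolynomial.esymm (Fin n) ℝ h, fun f => by
    simp [esymmSigned, MvPolynomial.esymm]⟩

theorem exists_eval_eq_Pmat (m : ℕ) (i j : Fin m) :
    ∃ p : MvPolynomial (Fin m) ℝ, ∀ lam : Fin m → ℝ, Pmat m lam i j = MvPolynomial.eval lam p := by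
  induction m with
  | zero => exact i.elim0
  | succ n ih =>
    by_cases hi : (i : ℕ) < n
    · by_cases hj : (j : ℕ) < n
      · obtain ⟨p, hp⟩ := ih ⟨i, hi⟩ ⟨j, hj⟩
        refine ⟨MvPolynomial.rename Fin.castSucc p, fun lam => ?_⟩
        simp [Pmat, hi, hj, hp, MvPolynomial.eval_rename, Function.comp_def]
      · exact ⟨0, fun lam => by simp [Pmat, hi, hj]⟩
    · by_cases hj : (j : ℕ) < n
      · obtain ⟨p, hp⟩ := exists_eval_eq_esymmSigned (n := n) (n - (j : ℕ))
        refine ⟨MvPolynomial.rename Fin.castSucc p, fun lam => ?_⟩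
        simp [Pmat, hi, hj, hp, MvPolynomial.eval_rename, Function.comp_def]
      · exact ⟨1, fun lam => by simp [Pmat, hi, hj]⟩

/-- The coefficient of `ε ^ (2 * k)` in the quasi-symmetriser: the sum over all permutations of the
rank-one matrices built from the `k`-th row, counted from the bottom, of `P^{(m)}(λ_ρ)`. -/
noncomputable def Qcoeff {m : ℕ} (k : Fin m) (lam : Fin m → ℝ) : Matrix (Fin m) (Fin m) ℝ :=
  ∑ ρ : Equiv.Perm (Fin m),
    vecMulVec (Pmat m (fun x => lam (ρ x)) k.rev) (Pmat m (fun x => lam (ρ x)) k.rev)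

theorem Qcoeff_posSemidef {m : ℕ} (k : Fin m) (lam : Fin m → ℝ) : (Qcoeff k lam).PosSemidef :=
  posSemidef_sum _ fun ρ _ => by
    simpa using posSemidef_vecMulVec_self_star (Pmat m (fun x => lam (ρ x)) k.rev)

theorem Qcoeff_isSymm {m : ℕ} (k : Fin m) (lam : Fin m → ℝ) : (Qcoeff k lam).IsSymm := by
  simp [IsSymm, Qcoeff, transpose_sum, transpose_vecMulVec]

theorem Qeps_eq_sum_Qcoeff (m : ℕ) (eps : ℝ) (lam : Fin m → ℝ) :
    Qeps m eps lam = ∑ k : Fin m, eps ^ (2 * (k : ℕ)) • Qcoeff k lam := by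
  simp only [Qcoeff, Finset.smul_sum]
  rw [Finset.sum_comm, Qeps]
  refine Finset.sum_congr rfl fun ρ _ => ?_
  ext i j
  rw [mul_apply, Matrix.sum_apply, ← Equiv.sum_comp Fin.revPerm]
  refine Finset.sum_congr rfl fun k _ => ?_
  have hk : m - 1 - (m - ((k : ℕ) + 1)) = k := by omega
  simp only [Peps, transpose_apply, diagonal_mul, Fin.revPerm_apply, Fin.val_rev, hk,
    Matrix.smul_apply, vecMulVec_apply, smul_eq_mul]
  ring

theorem exists_eval_eq_Qcoeff {m : ℕ} (k i j : Fin m) :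
    ∃ p : MvPolynomial (Fin m) ℝ, ∀ lam : Fin m → ℝ, Qcoeff k lam i j = MvPolynomial.eval lam p := by
  obtain ⟨p, hp⟩ := exists_eval_eq_Pmat m k.rev i
  obtain ⟨q, hq⟩ := exists_eval_eq_Pmat m k.rev j
  refine ⟨∑ ρ : Equiv.Perm (Fin m), MvPolynomial.rename ρ (p * q), fun lam => ?_⟩
  simp [Qcoeff, Matrix.sum_apply, vecMulVec_apply, hp, hq, MvPolynomial.eval_rename, Function.comp_def]

theorem Qcoeff_comp_perm {m : ℕ} (k : Fin m) (lam : Fin m → ℝ) (ρ : Equiv.Perm (Fin m)) :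
    Qcoeff k (fun x => lam (ρ x)) = Qcoeff k lam :=
  Equiv.sum_comp (Equiv.mulLeft ρ) fun τ : Equiv.Perm (Fin m) =>
    vecMulVec (Pmat m (fun x => lam (τ x)) k.rev) (Pmat m (fun x => lam (τ x)) k.rev)

/-- (Proposition 1 (i) of the paper.) The quasi-symmetriser decomposes as
`Q_ε^{(m)}(λ) = ∑_{i=0}^{m-1} ε^{2i} Q_i^{(m)}(λ)` with `Q_i^{(m)}(λ)` symmetric, positive
semidefinite, with polynomial entries that are symmetric in `λ_1, …, λ_m`. -/
theorem stmt5 (m : ℕ) (hm : 1 ≤ m) :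
    ∃ Qi : Fin m → (Fin m → ℝ) → Matrix (Fin m) (Fin m) ℝ,
      (∀ (k : Fin m) (lam : Fin m → ℝ), (Qi k lam).IsSymm ∧ (Qi k lam).PosSemidef) ∧
      (∀ (lam : Fin m → ℝ), ∀ eps ∈ Set.Ioc (0 : ℝ) 1,
          Qeps m eps lam = ∑ k : Fin m, eps ^ (2 * (k : ℕ)) • Qi k lam) ∧
      (∀ (k : Fin m) (i j : Fin m), ∃ p : MvPolynomial (Fin m) ℝ,
          ∀ lam : Fin m → ℝ, Qi k lam i j = MvPolynomial.eval lam p) ∧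
      (∀ (k : Fin m) (lam : Fin m → ℝ) (ρ : Equiv.Perm (Fin m)),
          Qi k (fun x => lam (ρ x)) = Qi k lam) := by
  exact ⟨Qcoeff, fun k lam => ⟨Qcoeff_isSymm k lam, Qcoeff_posSemidef k lam⟩,
    fun lam eps _ => Qeps_eq_sum_Qcoeff m eps lam, exists_eval_eq_Qcoeff, Qcoeff_comp_perm⟩
end

section
/- For every m ≥ 2, every λ ∈ ℝ^m and every ε ∈ (0,1]: Q_ε^{(m)}(λ) = Q_0^{(m)}(λ) + ε² Σ_{i=1}^m (Q_ε^{(m−1)}(π_iλ))^♯, where for an (m−1)×(m−1) matrix T, T^♯ denotes the m×m matrix whose top-left (m−1)×(m−1) block is T and all other entries are 0. -/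
open Matrix

/-- For an `(m-1) × (m-1)` matrix `T`, `sharp m T` is the `m × m` matrix whose top-left
`(m-1) × (m-1)` block is `T` and whose remaining entries vanish. -/
noncomputable def sharp (m : ℕ) (T : Matrix (Fin (m - 1)) (Fin (m - 1)) ℝ) :
    Matrix (Fin m) (Fin m) ℝ :=
  Matrix.of fun i j =>
    if hi : (i : ℕ) < m - 1 then
      if hj : (j : ℕ) < m - 1 then T ⟨i, hi⟩ ⟨j, hj⟩ else 0
    else 0

/-- The permutation of `Fin (n + 1)` sending the last index to `i` and acting on the remaining
indices as `τ`, followed by the order embedding that avoids `i`. -/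
def permOfLast {n : ℕ} (p : Fin (n + 1) × Equiv.Perm (Fin n)) : Equiv.Perm (Fin (n + 1)) :=
  ((finSuccEquiv' (Fin.last n)).trans (Equiv.optionCongr p.2)).trans (finSuccEquiv' p.1).symm

lemma permOfLast_last {n : ℕ} (p : Fin (n + 1) × Equiv.Perm (Fin n)) :
    permOfLast p (Fin.last n) = p.1 := by
  simp [permOfLast]

lemma permOfLast_castSucc {n : ℕ} (p : Fin (n + 1) × Equiv.Perm (Fin n)) (k : Fin n) :
    permOfLast p k.castSucc = p.1.succAbove (p.2 k) := by
  have h : finSuccEquiv' (Fin.last n) k.castSucc = some k := by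
    rw [← Fin.succAbove_last_apply, finSuccEquiv'_succAbove]
  simp [permOfLast, h]

lemma permOfLast_bijective (n : ℕ) : Function.Bijective (permOfLast (n := n)) := by
  rw [Fintype.bijective_iff_injective_and_card]
  constructor
  · rintro ⟨i, τ⟩ ⟨i', τ'⟩ h
    obtain rfl : i = i' := by
      simpa only [permOfLast_last] using DFunLike.congr_fun h (Fin.last n)
    congr 1
    ext1 k
    simpa only [permOfLast_castSucc, Fin.succAbove_right_inj] using
      DFunLike.congr_fun h k.castSucc
  · simp [Fintype.card_perm, Nat.factorial_succ]

/-- Summing over the permutations of `Fin (n + 1)` a function of their restriction to the first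
`n` indices. -/
lemma sum_perm_castSucc {n : ℕ} {M α : Type*} [AddCommMonoid M] (F : (Fin n → α) → M)
    (f : Fin (n + 1) → α) :
    ∑ ρ : Equiv.Perm (Fin (n + 1)), F (fun k => f (ρ k.castSucc)) =
      ∑ i : Fin (n + 1), ∑ τ : Equiv.Perm (Fin n), F (fun k => f (i.succAbove (τ k))) := by
  rw [← Fintype.sum_prod_type', ← (permOfLast_bijective n).sum_comp]
  simp only [permOfLast_castSucc]

lemma removeIdx_succ_apply {n : ℕ} (lam : Fin (n + 1) → ℝ) (i : Fin (n + 1)) (j : Fin n) :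
    removeIdx lam i j = lam (i.succAbove j) := by
  unfold removeIdx Fin.succAbove
  simp only [Fin.lt_def, Fin.val_castSucc]
  split_ifs <;> rfl

/-- `sharp` as an additive homomorphism. -/
noncomputable def sharpHom (m : ℕ) :
    Matrix (Fin (m - 1)) (Fin (m - 1)) ℝ →+ Matrix (Fin m) (Fin m) ℝ where
  toFun := sharp m
  map_zero' := by ext i j; simp [sharp]
  map_add' S T := by
    ext i j
    simp only [sharp, of_apply, Matrix.add_apply]
    split_ifs <;> simp

lemma sharp_sum {m : ℕ} {ι : Type*} (s : Finset ι)
    (T : ι → Matrix (Fin (m - 1)) (Fin (m - 1)) ℝ) :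
    sharp m (∑ i ∈ s, T i) = ∑ i ∈ s, sharp m (T i) :=
  map_sum (sharpHom m) T s

lemma Peps_apply (m : ℕ) (eps : ℝ) (lam : Fin m → ℝ) (i j : Fin m) :
    Peps m eps lam i j = eps ^ (m - 1 - (i : ℕ)) * Pmat m lam i j := by
  simp only [Peps, diagonal_mul]

lemma Peps_gram_succ (n : ℕ) (eps : ℝ) (lam : Fin (n + 1) → ℝ) :
    (Peps (n + 1) eps lam)ᵀ * Peps (n + 1) eps lam =
      (Peps (n + 1) 0 lam)ᵀ * Peps (n + 1) 0 lam +
        eps ^ 2 • sharp (n + 1) ((Peps n eps (fun k => lam k.castSucc))ᵀ *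
          Peps n eps (fun k => lam k.castSucc)) := by
  have hpow (x : ℝ) (i : Fin n) : x ^ (n - (i : ℕ)) = x * x ^ (n - 1 - (i : ℕ)) := by
    rw [← pow_succ']
    congr 1
    omega
  ext j k
  simp only [Peps_apply, sharp, mul_apply, transpose_apply, Matrix.add_apply, Matrix.smul_apply, of_apply,
    Fin.sum_univ_castSucc, Fin.val_castSucc, Fin.val_last, Nat.add_sub_cancel,
    Nat.sub_self, pow_zero, hpow, Pmat, Fin.is_lt, dite_true, smul_eq_mul]
  by_cases hj : (j : ℕ) < n <;> by_cases hk : (k : ℕ) < n <;>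
    simp [hj, hk, Finset.mul_sum]
  rw [add_comm]
  congr 1
  exact Finset.sum_congr rfl fun i _ => by ring

/-- (Proposition 1 (iv) of the paper.)
`Q_ε^{(m)}(λ) = Q_0^{(m)}(λ) + ε² ∑_{i=1}^m (Q_ε^{(m-1)}(π_i λ))^♯`,
where `Q_0^{(m)}(λ) = Qeps m 0 lam` (recall `H_0^{(m)} = diag(0, …, 0, 1)`). -/
theorem stmt8 (m : ℕ) (hm : 2 ≤ m) (lam : Fin m → ℝ) (eps : ℝ)
    (heps : eps ∈ Set.Ioc (0 : ℝ) 1) :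
    Qeps m eps lam =
      Qeps m 0 lam +
        eps ^ 2 • ∑ i : Fin m, sharp m (Qeps (m - 1) eps (removeIdx lam i)) := by
  obtain ⟨n, rfl⟩ : ∃ n, m = n + 1 := ⟨m - 1, by omega⟩
  have hsum := sum_perm_castSucc
    (fun f => sharp (n + 1) ((Peps n eps f)ᵀ * Peps n eps f)) lam
  have hQ (i : Fin (n + 1)) : sharp (n + 1) (Qeps n eps (removeIdx lam i)) =
      ∑ τ : Equiv.Perm (Fin n),
        sharp (n + 1) ((Peps n eps (fun k => lam (i.succAbove (τ k))))ᵀ *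
          Peps n eps (fun k => lam (i.succAbove (τ k)))) := by
    rw [← sharp_sum]
    unfold Qeps
    simp only [removeIdx_succ_apply]
  calc Qeps (n + 1) eps lam
      = ∑ ρ : Equiv.Perm (Fin (n + 1)), _ :=
        Finset.sum_congr rfl fun ρ _ => Peps_gram_succ n eps (fun k => lam (ρ k))
    _ = Qeps (n + 1) 0 lam + eps ^ 2 • ∑ i : Fin (n + 1),
          sharp (n + 1) (Qeps n eps (removeIdx lam i)) := by
        rw [Finset.sum_add_distrib, ← Finset.smul_sum, hsum]
        simp only [hQ]
        rfl
end

section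
/- For every m ≥ 1 and every λ ∈ ℝ^m: Q_0^{(m)}(λ) = (m−1)! · W^{(m)}(λ)^T W^{(m)}(λ). -/
open Matrix

/-- The matrix `W^{(m)}(λ)` whose `i`-th row is
`(σ_{m-1}^{(m-1)}(π_i λ), …, σ_1^{(m-1)}(π_i λ), 1)`. -/
noncomputable def Wmat (m : ℕ) (lam : Fin m → ℝ) : Matrix (Fin m) (Fin m) ℝ :=
  Matrix.of fun i j => esymmSigned (m - 1 - (j : ℕ)) (removeIdx lam i)

/-- The signed elementary symmetric function depends only on the multiset of values. -/
lemma esymmSigned_congr {n : ℕ} (h : ℕ) {f g : Fin n → ℝ}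
    (hfg : (Finset.univ : Finset (Fin n)).val.map f = (Finset.univ : Finset (Fin n)).val.map g) :
    esymmSigned h f = esymmSigned h g := by
  unfold esymmSigned
  rw [← Finset.esymm_map_val, ← Finset.esymm_map_val, hfg]

lemma removeIdx_eq_comp_succAbove {n : ℕ} (lam : Fin (n + 1) → ℝ) (i : Fin (n + 1)) :
    removeIdx lam i = fun j => lam (i.succAbove j) := by
  funext j
  unfold removeIdx
  split_ifs with h
  · rw [Fin.succAbove_of_castSucc_lt _ _ (by simpa [Fin.lt_def] using h)]
    rfl
  · rw [Fin.succAbove_of_le_castSucc _ _ (by simpa [Fin.le_def] using h)]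
    rfl

lemma map_univ_eq_cons_succAbove {n : ℕ} (f : Fin (n + 1) → ℝ) (i : Fin (n + 1)) :
    (Finset.univ : Finset (Fin (n + 1))).val.map f =
      f i ::ₘ (Finset.univ : Finset (Fin n)).val.map (fun j => f (i.succAbove j)) := by
  rw [Fin.univ_succAbove n i, Finset.cons_val, Finset.map_val, Multiset.map_cons,
    Multiset.map_map]
  rfl

/-- Dropping the last entry of a permuted vector amounts, up to order, to removing one entry of
the original vector. -/
lemma esymmSigned_perm_castSucc {n : ℕ} (h : ℕ) (lam : Fin (n + 1) → ℝ)
    (ρ : Equiv.Perm (Fin (n + 1))) :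
    esymmSigned h (fun k : Fin n => lam (ρ k.castSucc)) =
      esymmSigned h (fun j : Fin n => lam ((ρ (Fin.last n)).succAbove j)) := by
  apply esymmSigned_congr
  have h₁ := map_univ_eq_cons_succAbove (fun k => lam (ρ k)) (Fin.last n)
  have h₂ := map_univ_eq_cons_succAbove lam (ρ (Fin.last n))
  rw [← Multiset.map_univ_val_equiv ρ, Multiset.map_map] at h₂
  simp only [Fin.succAbove_last] at h₁
  exact (Multiset.cons_inj_right _).1 (h₁.symm.trans h₂)

/-- Each value is taken at a fixed point by exactly `n!` permutations of `Fin (n + 1)`. -/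
lemma sum_perm_apply_last {n : ℕ} (F : Fin (n + 1) → ℝ) :
    ∑ ρ : Equiv.Perm (Fin (n + 1)), F (ρ (Fin.last n)) = (n.factorial : ℝ) * ∑ i, F i := by
  rw [← Equiv.sum_comp (Equiv.mulRight (Equiv.swap 0 (Fin.last n))),
    ← Equiv.sum_comp Equiv.Perm.decomposeFin.symm, Fintype.sum_prod_type]
  simp [Fintype.card_perm, Finset.mul_sum]

lemma Pmat_last {n : ℕ} (lam : Fin (n + 1) → ℝ) (j : Fin (n + 1)) :
    Pmat (n + 1) lam (Fin.last n) j =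
      esymmSigned (n - (j : ℕ)) (fun k : Fin n => lam k.castSucc) := by
  simp only [Pmat, Matrix.of_apply, Fin.val_last, lt_irrefl, dite_false]
  split_ifs with hj
  · rfl
  · simp [Nat.sub_eq_zero_of_le (not_lt.1 hj), esymmSigned]

lemma Peps_zero_transpose_mul_self_apply {n : ℕ} (lam : Fin (n + 1) → ℝ) (a b : Fin (n + 1)) :
    ((Peps (n + 1) 0 lam)ᵀ * Peps (n + 1) 0 lam) a b =
      Pmat (n + 1) lam (Fin.last n) a * Pmat (n + 1) lam (Fin.last n) b := by
  rw [Matrix.mul_apply, Finset.sum_eq_single (Fin.last n)]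
  · simp [Peps, Matrix.diagonal_mul]
  · intro i _ hi
    have hlt : (i : ℕ) < n := Fin.val_lt_last hi
    have hne : n - (i : ℕ) ≠ 0 := by omega
    simp [Peps, Matrix.diagonal_mul, zero_pow hne]
  · simp

/-- (Proposition 1 (v) of the paper.)
`Q_0^{(m)}(λ) = (m-1)! W^{(m)}(λ)^T W^{(m)}(λ)`, where `Q_0^{(m)}(λ) = Qeps m 0 lam`
(recall `H_0^{(m)} = diag(0, …, 0, 1)`). -/
theorem stmt9 (m : ℕ) (hm : 1 ≤ m) (lam : Fin m → ℝ) :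
    Qeps m 0 lam = ((m - 1).factorial : ℝ) • ((Wmat m lam)ᵀ * Wmat m lam) := by
  obtain ⟨n, rfl⟩ := Nat.exists_eq_add_of_le' hm
  ext a b
  simp only [Qeps, Matrix.sum_apply, Peps_zero_transpose_mul_self_apply, Pmat_last,
    esymmSigned_perm_castSucc]
  rw [sum_perm_apply_last (fun i =>
    esymmSigned (n - (a : ℕ)) (fun j : Fin n => lam (i.succAbove j)) *
      esymmSigned (n - (b : ℕ)) (fun j : Fin n => lam (i.succAbove j)))]
  simp only [Matrix.smul_apply, Matrix.mul_apply, Matrix.transpose_apply, Wmat, Matrix.of_apply,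
    removeIdx_eq_comp_succAbove, smul_eq_mul, Nat.add_sub_cancel]
end

section
/- For every m ≥ 1 there exists a constant C_m > 0 such that for all λ = (λ_1,…,λ_m) ∈ ℝ^m: ∏_{j=1}^m ( Σ_{i=1}^m (σ_{m−j}^{(m−1)}(π_iλ))² ) ≤ C_m ∏_{1 ≤ i < j ≤ m} (λ_i² + λ_j²). (The left-hand side is, up to the factor ((m−1)!)^m, the product of the diagonal entries of Q_0^{(m)}(λ) = (m−1)!·W^{(m)}(λ)^T W^{(m)}(λ).) -/
/-- If `b ≤ b a` on `s`, a product of `h + 1` values of `b` over `insert a s` is at most `b a`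
times a product of `h` values over `s`. -/
theorem exists_subset_prod_le_mul_prod {ι : Type*} [DecidableEq ι] {b : ι → ℝ}
    (hb : ∀ i, 0 ≤ b i) {a : ι} {s : Finset ι} (hmax : ∀ x ∈ s, b x ≤ b a)
    {h : ℕ} {T : Finset ι} (hT : T ⊆ insert a s) (hcard : T.card = h + 1) :
    ∃ U ⊆ s, U.card = h ∧ ∏ i ∈ T, b i ≤ b a * ∏ i ∈ U, b i := by
  have key : ∃ x ∈ T, b x ≤ b a ∧ T.erase x ⊆ s := by
    by_cases haT : a ∈ T
    · exact ⟨a, haT, le_rfl, by rwa [← Finset.subset_insert_iff]⟩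
    · have hTs : T ⊆ s := (Finset.subset_insert_iff_of_notMem haT).1 hT
      obtain ⟨x, hx⟩ : T.Nonempty := Finset.card_pos.1 (by omega)
      exact ⟨x, hx, hmax x (hTs hx), (Finset.erase_subset _ _).trans hTs⟩
  obtain ⟨x, hx, hxa, hs⟩ := key
  refine ⟨T.erase x, hs, by rw [Finset.card_erase_of_mem hx]; omega, ?_⟩
  rw [← Finset.mul_prod_erase T b hx]
  exact mul_le_mul_of_nonneg_right hxa (Finset.prod_nonneg fun i _ => hb i)

/-- A product of subproducts of each size `h < #s` is controlled by the pairwise sums. -/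
theorem sq_prod_prod_le_prod_offDiag {ι : Type*} [DecidableEq ι] {b : ι → ℝ}
    (hb : ∀ i, 0 ≤ b i) (s : Finset ι) :
    ∀ S : ℕ → Finset ι, (∀ h < s.card, S h ⊆ s ∧ (S h).card = h) →
      (∏ h ∈ Finset.range s.card, ∏ i ∈ S h, b i) ^ 2 ≤ ∏ p ∈ s.offDiag, (b p.1 + b p.2) := by
  induction s using Finset.induction_on_max_value b with
  | empty => simp
  | insert a s has hmax ih =>
    intro S hS
    rw [Finset.card_insert_of_notMem has] at hS ⊢
    have hex : ∀ h, ∃ U : Finset ι, h < s.card →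
        U ⊆ s ∧ U.card = h ∧ ∏ i ∈ S (h + 1), b i ≤ b a * ∏ i ∈ U, b i := by
      intro h
      by_cases hh : h < s.card
      · obtain ⟨h₁, h₂⟩ := hS (h + 1) (by omega)
        obtain ⟨U, hU⟩ := exists_subset_prod_le_mul_prod hb hmax h₁ h₂
        exact ⟨U, fun _ => hU⟩
      · exact ⟨∅, fun h' => absurd h' hh⟩
    choose U hU using hex
    have hS0 : S 0 = ∅ := Finset.card_eq_zero.1 (hS 0 (by omega)).2
    have hpos : ∀ t : Finset ι, 0 ≤ ∏ i ∈ t, b i := fun t => Finset.prod_nonneg fun i _ => hb i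
    have h₁ : ∏ h ∈ Finset.range (s.card + 1), ∏ i ∈ S h, b i ≤
        b a ^ s.card * ∏ h ∈ Finset.range s.card, ∏ i ∈ U h, b i := by
      rw [Finset.prod_range_succ', hS0, Finset.prod_empty, mul_one]
      calc _ ≤ ∏ h ∈ Finset.range s.card, (b a * ∏ i ∈ U h, b i) :=
            Finset.prod_le_prod (fun _ _ => hpos _)
              fun h hh => (hU h (Finset.mem_range.1 hh)).2.2
        _ = _ := by simp [Finset.prod_mul_distrib]
    have h₂ := ih U fun h hh => ⟨(hU h hh).1, (hU h hh).2.1⟩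
    have h₃ : b a ^ s.card ≤ ∏ j ∈ s, (b a + b j) := by
      rw [← Finset.prod_const]
      exact Finset.prod_le_prod (fun _ _ => hb a) fun j _ => by linarith [hb j]
    have h₄ : ∏ p ∈ (insert a s).offDiag, (b p.1 + b p.2) =
        (∏ j ∈ s, (b a + b j)) ^ 2 * ∏ p ∈ s.offDiag, (b p.1 + b p.2) := by
      rw [Finset.offDiag_insert has, Finset.prod_union, Finset.prod_union,
        Finset.prod_product, Finset.prod_product]
      · simp only [Finset.prod_singleton, add_comm _ (b a)]
        ring
      · rw [Finset.disjoint_left]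
        rintro ⟨x, y⟩ hxy hxy'
        simp only [Finset.mem_offDiag, Finset.mem_product, Finset.mem_singleton] at hxy hxy'
        exact has (hxy'.1 ▸ hxy.1)
      · rw [Finset.disjoint_left]
        rintro ⟨x, y⟩ hxy hxy'
        simp only [Finset.mem_union, Finset.mem_offDiag, Finset.mem_product,
          Finset.mem_singleton] at hxy hxy'
        rcases hxy with hxy | hxy
        · exact has (hxy'.2 ▸ hxy.2.1)
        · exact has (hxy'.2 ▸ hxy.2)
    calc _ ≤ (b a ^ s.card * ∏ h ∈ Finset.range s.card, ∏ i ∈ U h, b i) ^ 2 :=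
          pow_le_pow_left₀ (Finset.prod_nonneg fun _ _ => hpos _) h₁ 2
      _ = (b a ^ s.card) ^ 2 * (∏ h ∈ Finset.range s.card, ∏ i ∈ U h, b i) ^ 2 := mul_pow _ _ _
      _ ≤ (∏ j ∈ s, (b a + b j)) ^ 2 * ∏ p ∈ s.offDiag, (b p.1 + b p.2) :=
          mul_le_mul (pow_le_pow_left₀ (pow_nonneg (hb a) _) h₃ 2) h₂ (sq_nonneg _)
            (sq_nonneg _)
      _ = _ := h₄.symm

theorem prod_offDiag_univ_eq_sq {m : ℕ} (b : Fin m → ℝ) :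
    ∏ p ∈ (Finset.univ : Finset (Fin m)).offDiag, (b p.1 + b p.2) =
      (∏ i : Fin m, ∏ j ∈ Finset.Ioi i, (b i + b j)) ^ 2 := by
  have h₁ := Finset.prod_prod_Ioi_mul_eq_prod_prod_off_diag fun i j : Fin m => b i + b j
  have h₂ : ∏ p ∈ (Finset.univ : Finset (Fin m)).offDiag, (b p.1 + b p.2) =
      ∏ i : Fin m, ∏ j ∈ {i}ᶜ, (b j + b i) := by
    simp only [add_comm (b _) (b _)]
    exact Finset.prod_finset_product' _ _ _ (f := fun i j => b i + b j) (by simp [eq_comm])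
  rw [h₂, ← h₁, ← Finset.prod_pow]
  refine Finset.prod_congr rfl fun i _ => ?_
  rw [← Finset.prod_pow]
  exact Finset.prod_congr rfl fun j _ => by ring

theorem removeIdx_eq_comp_injective {m : ℕ} (i : Fin m) :
    ∃ e : Fin (m - 1) → Fin m, Function.Injective e ∧
      ∀ lam : Fin m → ℝ, removeIdx lam i = lam ∘ e := by
  refine ⟨fun j => if (j : ℕ) < (i : ℕ) then ⟨j, by omega⟩ else ⟨(j : ℕ) + 1, by omega⟩, ?_, ?_⟩
  · intro j k hjk
    simp only at hjk
    split_ifs at hjk <;> simp only [Fin.mk.injEq] at hjk <;> omega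
  · intro lam
    funext j
    simp only [removeIdx, Function.comp]
    split_ifs <;> rfl

theorem sq_esymmSigned_comp_le {n m h : ℕ} {e : Fin n → Fin m} (he : Function.Injective e)
    (lam : Fin m → ℝ) {B : ℝ}
    (hB : ∀ T : Finset (Fin m), T.card = h → ∏ i ∈ T, lam i ^ 2 ≤ B) :
    esymmSigned h (lam ∘ e) ^ 2 ≤ (n.choose h : ℝ) ^ 2 * B := by
  rw [esymmSigned, mul_pow, ← pow_mul, mul_comm h 2, pow_mul, neg_one_sq, one_pow, one_mul]
  refine sq_sum_le_card_mul_sum_sq.trans ?_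
  have hterm : ∀ T ∈ Finset.powersetCard h (Finset.univ : Finset (Fin n)),
      (∏ i ∈ T, (lam ∘ e) i) ^ 2 ≤ B := by
    intro T hT
    have := hB (T.map ⟨e, he⟩) (by simpa using (Finset.mem_powersetCard.1 hT).2)
    simpa [Finset.prod_pow] using this
  have hsum := Finset.sum_le_card_nsmul _ _ _ hterm
  rw [Finset.card_powersetCard, Finset.card_univ, Fintype.card_fin, nsmul_eq_mul] at hsum
  rw [Finset.card_powersetCard, Finset.card_univ, Fintype.card_fin, sq, mul_assoc]
  exact mul_le_mul_of_nonneg_left hsum (Nat.cast_nonneg _)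

/-- (Proposition 1 (vii) of the paper.) There is `C_m > 0` with
`∏_{j=1}^m ( ∑_{i=1}^m σ_{m-j}^{(m-1)}(π_i λ)² ) ≤ C_m ∏_{i<j} (λ_i² + λ_j²)`. -/
theorem stmt11 (m : ℕ) (hm : 1 ≤ m) :
    ∃ C : ℝ, 0 < C ∧
      ∀ lam : Fin m → ℝ,
        ∏ j : Fin m, (∑ i : Fin m, esymmSigned (m - 1 - (j : ℕ)) (removeIdx lam i) ^ 2) ≤
          C * ∏ i : Fin m, ∏ j ∈ Finset.Ioi i, (lam i ^ 2 + lam j ^ 2) := by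
  refine ⟨∏ h ∈ Finset.range m, (m * ((m - 1).choose h : ℝ) ^ 2), ?_, fun lam => ?_⟩
  · refine Finset.prod_pos fun h hh => ?_
    have hh' : h ≤ m - 1 := by have := Finset.mem_range.1 hh; omega
    have := Nat.choose_pos hh'
    positivity
  have hex : ∀ h, ∃ S : Finset (Fin m), h < m → S.card = h ∧
      ∀ T : Finset (Fin m), T.card = h → ∏ i ∈ T, lam i ^ 2 ≤ ∏ i ∈ S, lam i ^ 2 := by
    intro h
    by_cases hh : h < m
    · obtain ⟨S, hS, hmax⟩ := Finset.exists_max_image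
        (Finset.powersetCard h (Finset.univ : Finset (Fin m))) (fun T => ∏ i ∈ T, lam i ^ 2)
        (Finset.powersetCard_nonempty.2 (by simpa using hh.le))
      exact ⟨S, fun _ => ⟨(Finset.mem_powersetCard.1 hS).2, fun T hT =>
        hmax T (Finset.mem_powersetCard.2 ⟨Finset.subset_univ _, hT⟩)⟩⟩
    · exact ⟨∅, fun h' => absurd h' hh⟩
  choose S hS using hex
  have hprod : ∏ h ∈ Finset.range m, ∏ i ∈ S h, lam i ^ 2 ≤
      ∏ i : Fin m, ∏ j ∈ Finset.Ioi i, (lam i ^ 2 + lam j ^ 2) := by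
    have h₁ := sq_prod_prod_le_prod_offDiag (b := fun i => lam i ^ 2) (fun i => sq_nonneg _)
      Finset.univ S fun h hh => ⟨Finset.subset_univ _, (hS h (by simpa using hh)).1⟩
    rw [prod_offDiag_univ_eq_sq fun i => lam i ^ 2, Finset.card_univ, Fintype.card_fin] at h₁
    exact le_of_sq_le_sq h₁ (by positivity)
  rw [Fin.prod_univ_eq_prod_range
    (fun j => ∑ i : Fin m, esymmSigned (m - 1 - j) (removeIdx lam i) ^ 2) m,
    Finset.prod_range_reflect (fun h => ∑ i : Fin m, esymmSigned h (removeIdx lam i) ^ 2) m]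
  calc _ ≤ ∏ h ∈ Finset.range m,
        ((m * ((m - 1).choose h : ℝ) ^ 2) * ∏ i ∈ S h, lam i ^ 2) := by
        refine Finset.prod_le_prod (fun h _ => by positivity) fun h hh => ?_
        have hterm : ∀ i ∈ (Finset.univ : Finset (Fin m)),
            esymmSigned h (removeIdx lam i) ^ 2 ≤
              ((m - 1).choose h : ℝ) ^ 2 * ∏ i ∈ S h, lam i ^ 2 := by
          intro i _
          obtain ⟨e, he, hcomp⟩ := removeIdx_eq_comp_injective i
          rw [hcomp]
          exact sq_esymmSigned_comp_le he lam (hS h (Finset.mem_range.1 hh)).2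
        simpa [mul_assoc] using Finset.sum_le_card_nsmul _ _ _ hterm
    _ = (∏ h ∈ Finset.range m, (m * ((m - 1).choose h : ℝ) ^ 2)) *
        ∏ h ∈ Finset.range m, ∏ i ∈ S h, lam i ^ 2 := Finset.prod_mul_distrib
    _ ≤ _ := mul_le_mul_of_nonneg_left hprod (by positivity)
end

section
/- Let T > 0 and let f be a real-valued function that is real-analytic on an open interval containing [0, T] and is not identically zero on [0, T]. Then there exist N ∈ ℕ and points 0 = τ_0 < τ_1 < ⋯ < τ_N = T such that f(t) ≠ 0 for every t in each open interval (τ_h, τ_{h+1}), 0 ≤ h ≤ N−1, and there exists a constant C > 0 such that |f′(t)| ≤ C · ( 1/(t − τ_h) + 1/(τ_{h+1} − t) ) · |f(t)| for all t ∈ (τ_h, τ_{h+1}) and all 0 ≤ h ≤ N−1. -/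
open Filter Topology

/-- Near a point where it is not locally zero, an analytic function has logarithmic derivative
of size at most a multiple of the inverse distance to that point. -/
theorem AnalyticAt.exists_abs_deriv_le_div_abs_sub_mul {f : ℝ → ℝ} {x : ℝ}
    (hf : AnalyticAt ℝ f x) (hne : ¬ ∀ᶠ t in 𝓝 x, f t = 0) :
    ∃ K : ℝ, ∀ᶠ t in 𝓝 x, t ≠ x → f t ≠ 0 ∧ |deriv f t| ≤ K / |t - x| * |f t| := by
  obtain ⟨n, g, hg, hgx, hfg⟩ := hf.exists_eventuallyEq_pow_smul_nonzero_iff.mpr hne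
  have hbound : ∀ᶠ t in 𝓝 x, |deriv g t / g t| < |deriv g x / g x| + 1 :=
    (hg.deriv.continuousAt.div hg.continuousAt hgx).abs.eventually_lt continuousAt_const
      (lt_add_one _)
  refine ⟨n + (|deriv g x / g x| + 1), ?_⟩
  filter_upwards [hbound, hfg.eventually_nhds, hg.continuousAt.eventually_ne hgx,
    hg.eventually_analyticAt, Metric.ball_mem_nhds x one_pos] with t hM hft hgt hgat ht htx
  have hd : t - x ≠ 0 := sub_ne_zero.mpr htx
  have hd1 : |t - x| ≤ 1 := (Real.dist_eq t x ▸ Metric.mem_ball.mp ht).le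
  have hval : f t = (t - x) ^ n * g t := by simpa using hft.self_of_nhds
  have hf0 : f t ≠ 0 := hval ▸ mul_ne_zero (pow_ne_zero n hd) hgt
  have hderiv : deriv f t = (n / (t - x) + deriv g t / g t) * f t := by
    have h : HasDerivAt (fun s => (s - x) ^ n * g s)
        (n * (t - x) ^ (n - 1) * 1 * g t + (t - x) ^ n * deriv g t) t :=
      (((hasDerivAt_id t).sub_const x).pow n).mul hgat.differentiableAt.hasDerivAt
    have heq : f =ᶠ[𝓝 t] fun s => (s - x) ^ n * g s := hft
    rw [heq.deriv_eq, h.deriv, hval]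
    rcases n with _ | n
    · field_simp
      simp
    · simp only [Nat.add_sub_cancel]
      field_simp
      ring
  refine ⟨hf0, ?_⟩
  rw [hderiv, abs_mul]
  gcongr
  have hpos : 0 < |t - x| := abs_pos.mpr hd
  calc |n / (t - x) + deriv g t / g t| ≤ |n / (t - x)| + |deriv g t / g t| := abs_add_le _ _
    _ ≤ n / |t - x| + (|deriv g x / g x| + 1) / |t - x| := by
      gcongr
      · rw [abs_div, Nat.abs_cast]
      · exact hM.le.trans (le_div_self (by positivity) hpos hd1)
    _ = _ := (add_div _ _ _).symm

/-- The distance from a point of `(c, d)` to a point outside is at least the distance to one of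
the endpoints. -/
theorem one_div_abs_sub_le_of_notMem_Ioo {c d t x : ℝ} (ht : t ∈ Set.Ioo c d)
    (hx : x ∉ Set.Ioo c d) : 1 / |t - x| ≤ 1 / (t - c) + 1 / (d - t) := by
  have hc : 0 < t - c := sub_pos.mpr ht.1
  have hd : 0 < d - t := sub_pos.mpr ht.2
  rcases le_or_gt x c with h | h
  · have : 1 / |t - x| ≤ 1 / (t - c) :=
      one_div_le_one_div_of_le hc ((by linarith : t - c ≤ t - x).trans (le_abs_self _))
    have : 0 < 1 / (d - t) := by positivity
    linarith
  · have hdx : d ≤ x := not_lt.mp fun h' => hx ⟨h, h'⟩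
    have : 1 / |t - x| ≤ 1 / (d - t) :=
      one_div_le_one_div_of_le hd
        ((by linarith : d - t ≤ -(t - x)).trans (neg_le_abs _))
    have : 0 < 1 / (t - c) := by positivity
    linarith

/-- Consecutive elements in the increasing enumeration of a finite set have no element of the
set strictly between them. -/
theorem Finset.notMem_Ioo_orderEmbOfFin {α : Type*} [LinearOrder α] {s : Finset α} {N : ℕ}
    (hs : s.card = N + 1) (h : Fin N) {x : α} (hx : x ∈ s) :
    x ∉ Set.Ioo (s.orderEmbOfFin hs h.castSucc) (s.orderEmbOfFin hs h.succ) := by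
  rintro ⟨h₁, h₂⟩
  obtain ⟨j, rfl⟩ : x ∈ Set.range (s.orderEmbOfFin hs) := by simpa using hx
  rw [OrderEmbedding.lt_iff_lt, Fin.lt_def] at h₁ h₂
  simp only [Fin.val_castSucc, Fin.val_succ] at h₁ h₂
  omega

/-- (Lemma on analytic functions, Lemma 5 of Garetto–Ruzhansky.) A
real-analytic function on an open interval containing `[0, T]`, not identically zero on
`[0, T]`, admits a finite partition `0 = τ_0 < τ_1 < ⋯ < τ_N = T` such that `f` does not
vanish on any open subinterval `(τ_h, τ_{h+1})` and
`|f'(t)| ≤ C (1/(t - τ_h) + 1/(τ_{h+1} - t)) |f(t)|` there. -/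
theorem stmt18 (T : ℝ) (hT : 0 < T) (f : ℝ → ℝ) (a b : ℝ) (ha : a < 0) (hb : T < b)
    (hf : AnalyticOnNhd ℝ f (Set.Ioo a b))
    (hne : ∃ t ∈ Set.Icc (0 : ℝ) T, f t ≠ 0) :
    ∃ (N : ℕ) (τ : Fin (N + 1) → ℝ),
      τ 0 = 0 ∧ τ (Fin.last N) = T ∧ StrictMono τ ∧
      (∀ h : Fin N, ∀ t ∈ Set.Ioo (τ h.castSucc) (τ h.succ), f t ≠ 0) ∧
      ∃ C : ℝ, 0 < C ∧
        ∀ h : Fin N, ∀ t ∈ Set.Ioo (τ h.castSucc) (τ h.succ),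
          |deriv f t| ≤ C * (1 / (t - τ h.castSucc) + 1 / (τ h.succ - t)) * |f t| := by
  have hsub : Set.Icc 0 T ⊆ Set.Ioo a b := fun t ht => ⟨ha.trans_le ht.1, ht.2.trans_lt hb⟩
  have hloc : ∀ x ∈ Set.Icc 0 T, ∃ K : ℝ, ∀ᶠ t in 𝓝 x,
      t ≠ x → f t ≠ 0 ∧ |deriv f t| ≤ K / |t - x| * |f t| := fun x hx =>
    (hf x (hsub hx)).exists_abs_deriv_le_div_abs_sub_mul fun h0 => by
      obtain ⟨t, ht, hft⟩ := hne
      exact hft (hf.eqOn_zero_of_preconnected_of_eventuallyEq_zero isPreconnected_Ioo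
        (hsub hx) h0 (hsub ht))
  choose! K hK using hloc
  obtain ⟨s, hsI, hcover⟩ := isCompact_Icc.elim_nhds_subcover _ hK
  obtain ⟨M, hM⟩ := (s.image K).bddAbove
  let S : Finset ℝ := insert 0 (insert T s)
  have hSI : ∀ x ∈ S, x ∈ Set.Icc 0 T := by
    simp only [S, Finset.mem_insert]
    rintro x (rfl | rfl | hx)
    exacts [⟨le_rfl, hT.le⟩, ⟨hT.le, le_rfl⟩, hsI x hx]
  have h0S : 0 ∈ S := by simp [S]
  have hTS : T ∈ S := by simp [S]
  obtain ⟨N, hN⟩ : ∃ N, S.card = N + 1 :=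
    Nat.exists_eq_add_one.mpr (Finset.card_pos.mpr ⟨0, h0S⟩)
  let τ := S.orderEmbOfFin hN
  have hτ : ∀ i, τ i ∈ Set.Icc 0 T := fun i => hSI _ (S.orderEmbOfFin_mem hN i)
  have hτ_range : Set.range τ = S := S.range_orderEmbOfFin hN
  have hmain : ∀ h : Fin N, ∀ t ∈ Set.Ioo (τ h.castSucc) (τ h.succ), f t ≠ 0 ∧
      |deriv f t| ≤ max M 1 * (1 / (t - τ h.castSucc) + 1 / (τ h.succ - t)) * |f t| := by
    intro h t ht
    obtain ⟨x, hxs, hxt⟩ := Set.mem_iUnion₂.mp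
      (hcover ⟨(hτ _).1.trans ht.1.le, ht.2.le.trans (hτ _).2⟩)
    have hx : x ∉ Set.Ioo (τ h.castSucc) (τ h.succ) :=
      Finset.notMem_Ioo_orderEmbOfFin hN h (by simp [S, hxs])
    obtain ⟨hft, hle⟩ := hxt (ne_of_mem_of_not_mem ht hx)
    refine ⟨hft, hle.trans ?_⟩
    rw [div_eq_mul_one_div]
    gcongr
    · exact (hM (Finset.mem_coe.mpr (Finset.mem_image_of_mem K hxs))).trans (le_max_left _ _)
    · exact one_div_abs_sub_le_of_notMem_Ioo ht hx
  refine ⟨N, τ, ?_, ?_, τ.strictMono, fun h t ht => (hmain h t ht).1, max M 1, by positivity,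
    fun h t ht => (hmain h t ht).2⟩
  · obtain ⟨i, hi⟩ : (0 : ℝ) ∈ Set.range τ := hτ_range ▸ h0S
    exact le_antisymm (hi ▸ τ.monotone (Fin.zero_le i)) (hτ 0).1
  · obtain ⟨i, hi⟩ : T ∈ Set.range τ := hτ_range ▸ hTS
    exact le_antisymm (hτ _).2 (hi.symm.le.trans (τ.monotone (Fin.le_last i)))
end
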